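/- For every real number k > 1, the function F_k(x) := ∑_{q≥1} c_q(x)/q^{k+1} converges absolutely for every real x and defines a continuous function on ℝ; moreover, for every positive integer n one has n^k · ζ(k+1) · F_k(n) = σ_k(n), so x ↦ x^k ζ(k+1) F_k(x) is a continuous function interpolating the divisor function σ_k at positive integer arguments. -/

import Mathlib

open Finset

/-- The real-variable Ramanujan sum `c_q(x) = ∑_{1 ≤ k ≤ q, gcd(k,q)=1} e^{2πikx/q}`. -/
noncomputable def cq (q : ℕ) (x : ℝ) : ℂ :=
  ∑ k ∈ (Finset.Icc 1 q).filter (fun k => Nat.gcd k q = 1),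
    Complex.exp (2 * (Real.pi : ℂ) * Complex.I * (k : ℂ) * (x : ℂ) / (q : ℂ))

/-- The Riemann zeta function of a real argument `s > 1`, as the series `∑_{n≥1} n^{-s}`. -/
noncomputable def zetaR (s : ℝ) : ℝ := ∑' n : ℕ, 1 / (n + 1 : ℝ) ^ s

/-- The generalized divisor function `F_k(x) := ∑_{q≥1} c_q(x)/q^{k+1}` for a real
exponent `k`. -/
noncomputable def Fk (k : ℝ) (x : ℝ) : ℂ := ∑' q : ℕ, cq q x / (q : ℂ) ^ ((k : ℂ) + 1)

theorem norm_cq_le (q : ℕ) (x : ℝ) : ‖cq q x‖ ≤ q := by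
  unfold cq
  refine (norm_sum_le _ _).trans ?_
  have h : ∀ k ∈ (Finset.Icc 1 q).filter (fun k => Nat.gcd k q = 1),
      ‖Complex.exp (2 * (Real.pi : ℂ) * Complex.I * (k : ℂ) * (x : ℂ) / (q : ℂ))‖ = 1 := by
    intro k _
    have : 2 * (Real.pi : ℂ) * Complex.I * (k : ℂ) * (x : ℂ) / (q : ℂ)
        = ((2 * Real.pi * k * x / q : ℝ) : ℂ) * Complex.I := by
      push_cast; ring
    rw [this, Complex.norm_exp_ofReal_mul_I]
  rw [Finset.sum_congr rfl h, Finset.sum_const, nsmul_eq_mul, mul_one]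
  exact_mod_cast (Finset.card_filter_le _ _).trans (by simp)

theorem continuous_cq (q : ℕ) : Continuous (cq q) := by
  unfold cq
  fun_prop

theorem norm_cq_div_le (k : ℝ) (q : ℕ) (x : ℝ) :
    ‖cq q x / (q : ℂ) ^ ((k : ℂ) + 1)‖ ≤ 1 / (q : ℝ) ^ k := by
  rcases Nat.eq_zero_or_pos q with rfl | hq
  · simp only [cq, Finset.Icc_eq_empty_of_lt zero_lt_one, Finset.filter_empty, Finset.sum_empty,
      zero_div, norm_zero]
    positivity
  · have hq' : (0 : ℝ) < q := by exact_mod_cast hq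
    rw [norm_div, Complex.norm_natCast_cpow_of_pos hq]
    have : ((k : ℂ) + 1).re = k + 1 := by simp
    rw [this, Real.rpow_add hq', Real.rpow_one, div_le_div_iff₀ (by positivity) (by positivity)]
    have := norm_cq_le q x
    have h2 : 0 < (q : ℝ) ^ k := by positivity
    nlinarith

/-- The terms with `gcd(j, N) = d` of the sum of all `N`-th roots of unity form `c_{N/d}`. -/
theorem sum_gcd_eq_cq {N d : ℕ} (hN : 0 < N) (hd : d ∣ N) (x : ℝ) :
    ∑ j ∈ (Finset.Icc 1 N).filter (fun j => Nat.gcd j N = d),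
      Complex.exp (2 * (Real.pi : ℂ) * Complex.I * (j : ℂ) * (x : ℂ) / (N : ℂ)) =
    cq (N / d) x := by
  obtain ⟨e, rfl⟩ := hd
  have hd : 0 < d := Nat.pos_of_mul_pos_right hN
  have he : 0 < e := Nat.pos_of_mul_pos_left hN
  rw [Nat.mul_div_cancel_left _ hd]
  unfold cq
  symm
  refine Finset.sum_bij (fun k _ => d * k) ?_ ?_ ?_ ?_
  · intro k hk
    simp only [Finset.mem_filter, Finset.mem_Icc] at hk ⊢
    refine ⟨⟨Nat.mul_pos hd hk.1.1, Nat.mul_le_mul_left _ hk.1.2⟩, ?_⟩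
    rw [Nat.gcd_mul_left, hk.2, mul_one]
  · intro a _ b _ h
    exact Nat.eq_of_mul_eq_mul_left hd h
  · intro j hj
    simp only [Finset.mem_filter, Finset.mem_Icc] at hj
    obtain ⟨m, rfl⟩ : d ∣ j := hj.2 ▸ Nat.gcd_dvd_left _ _
    refine ⟨m, ?_, rfl⟩
    simp only [Finset.mem_filter, Finset.mem_Icc]
    refine ⟨⟨Nat.pos_of_mul_pos_left hj.1.1, Nat.le_of_mul_le_mul_left hj.1.2 hd⟩, ?_⟩
    have := hj.2
    rw [Nat.gcd_mul_left] at this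
    exact Nat.eq_of_mul_eq_mul_left hd (by rw [this, mul_one])
  · intro k _
    congr 1
    have : (d : ℂ) ≠ 0 := by exact_mod_cast hd.ne'
    have : (e : ℂ) ≠ 0 := by exact_mod_cast he.ne'
    push_cast
    field_simp

theorem sum_divisors_cq {N : ℕ} (hN : 0 < N) (x : ℝ) :
    ∑ q ∈ N.divisors, cq q x =
    ∑ j ∈ Finset.Icc 1 N,
      Complex.exp (2 * (Real.pi : ℂ) * Complex.I * (j : ℂ) * (x : ℂ) / (N : ℂ)) := by
  have hmaps : ∀ j ∈ Finset.Icc 1 N, Nat.gcd j N ∈ N.divisors := fun j _ =>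
    Nat.mem_divisors.2 ⟨Nat.gcd_dvd_right _ _, hN.ne'⟩
  rw [← Nat.sum_div_divisors]
  refine Eq.trans ?_ (Finset.sum_fiberwise_of_maps_to hmaps _)
  exact Finset.sum_congr rfl fun d hd => (sum_gcd_eq_cq hN (Nat.dvd_of_mem_divisors hd) x).symm

theorem sum_exp_eq_ite {N : ℕ} (hN : 0 < N) (n : ℕ) :
    ∑ j ∈ Finset.Icc 1 N,
      Complex.exp (2 * (Real.pi : ℂ) * Complex.I * (j : ℂ) * ((n : ℝ) : ℂ) / (N : ℂ)) =
    if N ∣ n then (N : ℂ) else 0 := by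
  have hN' : (N : ℂ) ≠ 0 := by exact_mod_cast hN.ne'
  set z := Complex.exp (2 * Real.pi * Complex.I / N) with hz
  have hprim : IsPrimitiveRoot z N := Complex.isPrimitiveRoot_exp N hN.ne'
  have hterm : ∀ j ∈ Finset.Icc 1 N,
      Complex.exp (2 * (Real.pi : ℂ) * Complex.I * (j : ℂ) * ((n : ℝ) : ℂ) / (N : ℂ)) =
      (z ^ n) ^ j := by
    intro j _
    rw [← pow_mul, hz, ← Complex.exp_nat_mul]
    congr 1
    push_cast
    ring
  rw [Finset.sum_congr rfl hterm]
  split_ifs with h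
  · rw [(hprim.pow_eq_one_iff_dvd n).2 h]
    simp
  · have hne : z ^ n - 1 ≠ 0 := fun h' =>
      h ((hprim.pow_eq_one_iff_dvd n).1 (sub_eq_zero.1 h'))
    have hone : (z ^ n) ^ N = 1 := by rw [← pow_mul, mul_comm, pow_mul, hprim.pow_eq_one, one_pow]
    have hgeom : ∑ i ∈ Finset.range N, (z ^ n) ^ i = 0 := by
      have := geom_sum_mul (z ^ n) N
      rw [hone, sub_self] at this
      exact (mul_eq_zero.1 this).resolve_right hne
    have hshift : Finset.Icc 1 N = Finset.Ico 1 (N + 1) := by ext; simp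
    rw [hshift, Finset.sum_Ico_eq_sum_range]
    simp [pow_add, ← Finset.mul_sum, hgeom]

theorem Fk_eq_LSeries (k x : ℝ) : Fk k x = LSeries (fun q => cq q x) ((k : ℂ) + 1) := by
  refine tsum_congr fun q => ?_
  rw [LSeries.term_def]
  split_ifs with h
  · simp [h, cq]
  · rfl

theorem summable_norm_cq_div {k : ℝ} (hk : 1 < k) (x : ℝ) :
    Summable (fun q : ℕ => ‖cq q x / (q : ℂ) ^ ((k : ℂ) + 1)‖) :=
  (Real.summable_one_div_nat_rpow.2 hk).of_nonneg_of_le (fun _ => norm_nonneg _)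
    (fun q => norm_cq_div_le k q x)

theorem LSeriesSummable_cq {k : ℝ} (hk : 1 < k) (x : ℝ) :
    LSeriesSummable (fun q => cq q x) ((k : ℂ) + 1) := by
  refine (summable_norm_cq_div hk x).of_norm.congr fun q => ?_
  rw [LSeries.term_def]
  split_ifs with h
  · simp [h, cq]
  · rfl

theorem ofReal_zetaR {s : ℝ} (hs : 1 < s) : (zetaR s : ℂ) = LSeries 1 (s : ℂ) := by
  rw [LSeries_one_eq_riemannZeta (by simpa using hs),
    zeta_eq_tsum_one_div_nat_add_one_cpow (by simpa using hs), zetaR, Complex.ofReal_tsum]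
  refine tsum_congr fun n => ?_
  rw [Complex.ofReal_div, Complex.ofReal_cpow (by positivity)]
  push_cast
  rfl

theorem zetaR_mul_Fk {k : ℝ} (hk : 1 < k) {n : ℕ} (hn : 0 < n) :
    (zetaR (k + 1) : ℂ) * Fk k n = ∑ d ∈ n.divisors, 1 / (d : ℂ) ^ (k : ℂ) := by
  have hcast : ((k + 1 : ℝ) : ℂ) = (k : ℂ) + 1 := by push_cast; rfl
  have h1 : LSeriesSummable 1 ((k : ℂ) + 1) := by
    rw [LSeriesSummable_one_iff]
    simp
    linarith
  rw [ofReal_zetaR (by linarith), hcast, Fk_eq_LSeries,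
    ← LSeries_convolution' h1 (LSeriesSummable_cq hk n), LSeries, tsum_eq_sum (s := n.divisors)]
  · refine Finset.sum_congr rfl fun d hd => ?_
    have hd0 : d ≠ 0 := (Nat.pos_of_mem_divisors hd).ne'
    have hdc : (d : ℂ) ≠ 0 := by exact_mod_cast hd0
    rw [LSeries.term_of_ne_zero hd0, LSeries.convolution_def]
    simp only [Pi.one_apply, one_mul]
    rw [Nat.sum_divisorsAntidiagonal' (f := fun _ q => cq q n),
      sum_divisors_cq (Nat.pos_of_mem_divisors hd), sum_exp_eq_ite (Nat.pos_of_mem_divisors hd),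
      if_pos (Nat.dvd_of_mem_divisors hd), Complex.cpow_add _ _ hdc, Complex.cpow_one]
    have : (d : ℂ) ^ (k : ℂ) ≠ 0 := by simp [Complex.cpow_eq_zero_iff, hdc]
    field_simp
  · intro d hd
    rcases Nat.eq_zero_or_pos d with rfl | hd0
    · simp
    rw [LSeries.term_of_ne_zero hd0.ne', LSeries.convolution_def]
    simp only [Pi.one_apply, one_mul]
    rw [Nat.sum_divisorsAntidiagonal' (f := fun _ q => cq q n), sum_divisors_cq hd0,
      sum_exp_eq_ite hd0, if_neg (fun h => hd (Nat.mem_divisors.2 ⟨h, hn.ne'⟩)), zero_div]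

theorem continuous_Fk {k : ℝ} (hk : 1 < k) : Continuous (Fk k) :=
  continuous_tsum (fun q => (continuous_cq q).div_const _) (Real.summable_one_div_nat_rpow.2 hk)
    (fun q x => norm_cq_div_le k q x)

/-- For every real `k > 1`, the series `F_k(x) = ∑_{q≥1} c_q(x)/q^{k+1}` converges absolutely
for every real `x` and defines a continuous function on `ℝ`; moreover for every positive
integer `n` one has `n^k·ζ(k+1)·F_k(n) = σ_k(n)`, so `x ↦ x^k ζ(k+1) F_k(x)` is a continuous
function interpolating the divisor function `σ_k` at positive integers. -/
theorem stmt14 (k : ℝ) (hk : 1 < k) :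
    (∀ x : ℝ, Summable (fun q : ℕ => ‖cq q x / (q : ℂ) ^ ((k : ℂ) + 1)‖)) ∧
    Continuous (fun x : ℝ => Fk k x) ∧
    (∀ n : ℕ, 0 < n →
      (((n : ℝ) ^ k * zetaR (k + 1) : ℝ) : ℂ) * Fk k (n : ℝ)
        = ((∑ d ∈ n.divisors, (d : ℝ) ^ k : ℝ) : ℂ)) ∧
    Continuous (fun x : ℝ => ((x ^ k * zetaR (k + 1) : ℝ) : ℂ) * Fk k x) := by
  refine ⟨summable_norm_cq_div hk, continuous_Fk hk, fun n hn => ?_, ?_⟩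
  · rw [Complex.ofReal_mul, mul_assoc, zetaR_mul_Fk hk hn,
      ← Nat.sum_div_divisors n (fun d => (d : ℝ) ^ k), Complex.ofReal_sum, Finset.mul_sum]
    refine Finset.sum_congr rfl fun d hd => ?_
    have hdn := Nat.dvd_of_mem_divisors hd
    have hd0 : (d : ℝ) ≠ 0 := by exact_mod_cast (Nat.pos_of_mem_divisors hd).ne'
    rw [Nat.cast_div hdn hd0, Real.div_rpow (by positivity) (by positivity), Complex.ofReal_div,
      Complex.ofReal_cpow (Nat.cast_nonneg d), Complex.ofReal_natCast, mul_one_div]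
  · have hpow : Continuous fun x : ℝ => x ^ k := Real.continuous_rpow_const (by linarith)
    exact (Complex.continuous_ofReal.comp (hpow.mul_const _)).mul (continuous_Fk hk)
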